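/- arXiv:2601.11873 — 3 statements merged into one kernel-verified Lean document; each statement's English description precedes it below -/
import Mathlib

section
/- In a weakly dicomplemented lattice L, for all x, y ∈ L: (x ∧ y)^Δ = x^Δ ∨ y^Δ. -/
class WDL (L : Type*) [Lattice L] [BoundedOrder L] where
  delta : L → L
  nabla : L → L
  delta_delta_le : ∀ x : L, delta (delta x) ≤ x
  delta_antitone : ∀ x y : L, x ≤ y → delta y ≤ delta x
  meet_delta_eq : ∀ x y : L, (x ⊓ y) ⊔ (x ⊓ delta y) = x
  le_nabla_nabla : ∀ x : L, x ≤ nabla (nabla x)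
  nabla_antitone : ∀ x y : L, x ≤ y → nabla y ≤ nabla x
  join_nabla_eq : ∀ x y : L, (x ⊔ y) ⊓ (x ⊔ nabla y) = x

open WDL
theorem wdl_delta_inf (L : Type*) [Lattice L] [BoundedOrder L] [WDL L] (x y : L) :
    delta (x ⊓ y) = delta x ⊔ delta y := by
  have galois : ∀ a b : L, delta a ≤ b → delta b ≤ a := fun a b h =>
    (delta_antitone _ _ h).trans (delta_delta_le a)
  apply le_antisymm
  · apply galois
    exact le_inf (galois _ _ le_sup_left) (galois _ _ le_sup_right)
  · exact sup_le (delta_antitone _ _ inf_le_left) (delta_antitone _ _ inf_le_right)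
end

section
/- In a weakly dicomplemented lattice L, the skeleton S(L) = {x ∈ L | x^∇∇ = x} with operations x ∧ y, x ⊔ y := (x^∇ ∧ y^∇)^∇, complement x^∇, bounds 0 and 1, forms an ortholattice. -/
open WDL
/-- The skeleton of a weakly dicomplemented lattice. -/
def Skel (L : Type*) [Lattice L] [BoundedOrder L] [WDL L] : Set L :=
  {x | nabla (nabla x) = x}

/-- The skeleton, with meet inherited, join `x ⊔' y := (x^∇ ⊓ y^∇)^∇`,
orthocomplement `^∇` and bounds 0, 1, is an ortholattice. -/
theorem wdl_skeleton_ortholattice (L : Type*) [Lattice L] [BoundedOrder L] [WDL L] :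
    -- closure of the operations
    (∀ x ∈ Skel L, ∀ y ∈ Skel L, x ⊓ y ∈ Skel L) ∧
    (∀ x ∈ Skel L, ∀ y ∈ Skel L, nabla (nabla x ⊓ nabla y) ∈ Skel L) ∧
    (∀ x ∈ Skel L, nabla x ∈ Skel L) ∧
    (⊥ : L) ∈ Skel L ∧ (⊤ : L) ∈ Skel L ∧
    -- bounded lattice laws: x ⊓ y is the meet and (x^∇ ⊓ y^∇)^∇ the join in Skel L
    (∀ x ∈ Skel L, ∀ y ∈ Skel L, x ⊓ y ≤ x ∧ x ⊓ y ≤ y) ∧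
    (∀ x ∈ Skel L, ∀ y ∈ Skel L, ∀ z ∈ Skel L, z ≤ x → z ≤ y → z ≤ x ⊓ y) ∧
    (∀ x ∈ Skel L, ∀ y ∈ Skel L,
      x ≤ nabla (nabla x ⊓ nabla y) ∧ y ≤ nabla (nabla x ⊓ nabla y)) ∧
    (∀ x ∈ Skel L, ∀ y ∈ Skel L, ∀ z ∈ Skel L,
      x ≤ z → y ≤ z → nabla (nabla x ⊓ nabla y) ≤ z) ∧
    (∀ x ∈ Skel L, (⊥ : L) ≤ x ∧ x ≤ ⊤) ∧
    -- ortholattice axioms for `^∇` on the skeleton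
    (∀ x ∈ Skel L, ∀ y ∈ Skel L, x ≤ y → nabla y ≤ nabla x) ∧
    (∀ x ∈ Skel L, nabla (nabla x) = x) ∧
    (∀ x ∈ Skel L, nabla (nabla x ⊓ nabla (nabla x)) = ⊤) ∧
    (∀ x ∈ Skel L, x ⊓ nabla x = ⊥) := by 
  have nn := fun x : L => le_nabla_nabla x
  have anti : ∀ x y : L, x ≤ y → nabla y ≤ nabla x := nabla_antitone
  have n3 : ∀ x : L, nabla (nabla (nabla x)) = nabla x := fun x =>
    le_antisymm (anti _ _ (nn x)) (nn _)
  have hbot : ∀ x : L, x ⊓ nabla x = ⊥ := fun x => by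
    simpa using join_nabla_eq (⊥ : L) x
  have hnb : nabla (⊥ : L) = ⊤ :=
    top_le_iff.mp ((nn ⊤).trans (anti _ _ bot_le))
  have hnt : nabla (⊤ : L) = ⊥ := by simpa using hbot (⊤ : L)
  refine ⟨?_, fun x _ y _ => n3 _, fun x _ => n3 x, ?_, ?_,
    fun x _ y _ => ⟨inf_le_left, inf_le_right⟩,
    fun x _ y _ z _ h1 h2 => le_inf h1 h2, ?_, ?_,
    fun x _ => ⟨bot_le, le_top⟩, fun x _ y _ h => anti _ _ h, fun x h => h, ?_,
    fun x _ => hbot x⟩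
  · intro x hx y hy
    refine le_antisymm (le_inf ?_ ?_) (nn _)
    · exact (anti _ _ (anti _ _ inf_le_left)).trans (le_of_eq hx)
    · exact (anti _ _ (anti _ _ inf_le_right)).trans (le_of_eq hy)
  · change nabla (nabla (⊥ : L)) = ⊥
    rw [hnb, hnt]
  · change nabla (nabla (⊤ : L)) = ⊤
    rw [hnt, hnb]
  · intro x _ y _
    exact ⟨(nn x).trans (anti _ _ inf_le_left), (nn y).trans (anti _ _ inf_le_right)⟩
  · intro x _ y _ z hz h1 h2
    exact (anti _ _ (le_inf (anti _ _ h1) (anti _ _ h2))).trans (le_of_eq hz)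
  · intro x _
    rw [hbot, hnb]
end

section
/- Let L be a finite lattice with J(L) its set of join-irreducible elements and M(L) its set of meet-irreducible elements. Define x^Δ := ⋁{a ∈ J(L) | a ≰ x} and x^∇ := ⋀{m ∈ M(L) | x ≰ m}. Then (L; ∧, ∨, ^Δ, ^∇, 0, 1) is a weakly dicomplemented lattice. -/
open scoped Classical

/-- On a finite bounded lattice, `x^Δ := ⋁{a ∈ J(L) | a ≰ x}` and
`x^∇ := ⋀{m ∈ M(L) | x ≰ m}` define a weakly dicomplemented lattice. -/
theorem finite_lattice_wdl (L : Type*) [Fintype L] [Lattice L] [BoundedOrder L] :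
    let J : L → Prop := fun v => v ≠ (Finset.univ.filter (fun x => x < v)).sup id
    let M : L → Prop := fun v => v ≠ (Finset.univ.filter (fun x => v < x)).inf id
    let d : L → L := fun x => (Finset.univ.filter (fun a => J a ∧ ¬ a ≤ x)).sup id
    let n : L → L := fun x => (Finset.univ.filter (fun m => M m ∧ ¬ x ≤ m)).inf id
    (∀ x : L, d (d x) ≤ x) ∧
    (∀ x y : L, x ≤ y → d y ≤ d x) ∧
    (∀ x y : L, (x ⊓ y) ⊔ (x ⊓ d y) = x) ∧
    (∀ x : L, x ≤ n (n x)) ∧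
    (∀ x y : L, x ≤ y → n y ≤ n x) ∧
    (∀ x y : L, (x ⊔ y) ⊓ (x ⊔ n y) = x) := by 
  intro J M d n
  have keyJ : ∀ z x : L, (∀ a, J a → a ≤ x → a ≤ z) → x ≤ z := by
    intro z x
    induction x using WellFoundedLT.induction with
    | ind x ih =>
      intro h
      by_cases hx : J x
      · exact h x hx le_rfl
      · have hx' : x = (Finset.univ.filter (fun y => y < x)).sup id := not_not.mp hx
        rw [hx']
        refine Finset.sup_le fun y hy => ?_
        have hy' : y < x := (Finset.mem_filter.mp hy).2
        exact ih y hy' fun a ha hay => h a ha (hay.trans hy'.le)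
  have keyM : ∀ z x : L, (∀ a, M a → x ≤ a → z ≤ a) → z ≤ x := by
    intro z x
    induction x using WellFoundedGT.induction with
    | ind x ih =>
      intro h
      by_cases hx : M x
      · exact h x hx le_rfl
      · have hx' : x = (Finset.univ.filter (fun y => x < y)).inf id := not_not.mp hx
        rw [hx']
        refine Finset.le_inf fun y hy => ?_
        have hy' : x < y := (Finset.mem_filter.mp hy).2
        exact ih y hy' fun a ha hay => h a ha (hy'.le.trans hay)
  have led : ∀ a x : L, J a → ¬ a ≤ x → a ≤ d x := fun a x ha hax =>
    Finset.le_sup (f := id) (Finset.mem_filter.mpr ⟨Finset.mem_univ a, ha, hax⟩)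
  have dle : ∀ x z : L, (∀ a, J a → ¬ a ≤ x → a ≤ z) → d x ≤ z := fun x z h =>
    Finset.sup_le fun a ha =>
      h a (Finset.mem_filter.mp ha).2.1 (Finset.mem_filter.mp ha).2.2
  have nle : ∀ a x : L, M a → ¬ x ≤ a → n x ≤ a := fun a x ha hax =>
    Finset.inf_le (f := id) (Finset.mem_filter.mpr ⟨Finset.mem_univ a, ha, hax⟩)
  have len : ∀ x z : L, (∀ a, M a → ¬ x ≤ a → z ≤ a) → z ≤ n x := fun x z h =>
    Finset.le_inf fun a ha =>
      h a (Finset.mem_filter.mp ha).2.1 (Finset.mem_filter.mp ha).2.2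
  refine ⟨fun x => ?_, fun x y h => ?_, fun x y => ?_, fun x => ?_, fun x y h => ?_, fun x y => ?_⟩
  · exact dle _ _ fun a ha h => by_contra fun hax => h (led a x ha hax)
  · exact dle _ _ fun a ha hay => led a x ha fun hax => hay (hax.trans h)
  · refine le_antisymm (sup_le inf_le_left inf_le_left) (keyJ _ _ fun a ha hax => ?_)
    by_cases hy : a ≤ y
    · exact le_sup_of_le_left (le_inf hax hy)
    · exact le_sup_of_le_right (le_inf hax (led a y ha hy))
  · exact len _ _ fun a ha h => by_contra fun hax => h (nle a x ha hax)
  · exact len _ _ fun a ha hxa => nle a y ha fun hya => hxa (h.trans hya)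
  · refine le_antisymm (keyM _ _ fun a ha hax => ?_) (le_inf le_sup_left le_sup_left)
    by_cases hy : y ≤ a
    · exact inf_le_of_left_le (sup_le hax hy)
    · exact inf_le_of_right_le (sup_le hax (nle a y ha hy))
end
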